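/- Let a, b, c > 0, and define u(x, y, z) := ∫₀^∞ exp(−x²/(2(a + q)) − y²/(2(b + q)) − z²/(2(c + q))) / ((a + q)^{1/2}·(b + q)^{1/2}·(c + q)^{1/2}) dq. Then u is twice differentiable on ℝ³ and satisfies ∂²u/∂x² + ∂²u/∂y² + ∂²u/∂z² = −(2/(a·b·c)^{1/2})·exp(−x²/(2a) − y²/(2b) − z²/(2c)) for all (x, y, z). -/

import Mathlib

open MeasureTheory

/-- The unnormalised Gaussian with variances `a + q`, `b + q`, `c + q`. -/
noncomputable def gaussKernel (a b c : ℝ) (p : ℝ × ℝ × ℝ) (q : ℝ) : ℝ :=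
  Real.exp (-(p.1 ^ 2 / (2 * (a + q))) - p.2.1 ^ 2 / (2 * (b + q)) - p.2.2 ^ 2 / (2 * (c + q)))

/-- The superposition of the Gaussians `gaussKernel a b c · q`, `q > 0`, with weight `g`. -/
noncomputable def gaussMix (a b c : ℝ) (g : ℝ → ℝ) (p : ℝ × ℝ × ℝ) : ℝ :=
  ∫ q in Set.Ioi (0 : ℝ), g q * gaussKernel a b c p q

/-- The continuous linear functional on `ℝ × ℝ × ℝ` with coefficients `r`, `s`, `t`. -/
noncomputable def coordForm (r s t : ℝ) : ℝ × ℝ × ℝ →L[ℝ] ℝ :=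
  r • ContinuousLinearMap.fst ℝ ℝ (ℝ × ℝ) +
    s • (ContinuousLinearMap.fst ℝ ℝ ℝ).comp (ContinuousLinearMap.snd ℝ ℝ (ℝ × ℝ)) +
    t • (ContinuousLinearMap.snd ℝ ℝ ℝ).comp (ContinuousLinearMap.snd ℝ ℝ (ℝ × ℝ))

theorem coordForm_apply (r s t : ℝ) (v : ℝ × ℝ × ℝ) :
    coordForm r s t v = r * v.1 + s * v.2.1 + t * v.2.2 := by
  simp [coordForm]

theorem norm_coordForm_le (r s t : ℝ) : ‖coordForm r s t‖ ≤ |r| + |s| + |t| := by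
  refine ContinuousLinearMap.opNorm_le_bound _ (by positivity) fun v => ?_
  have h1 : ‖v.1‖ ≤ ‖v‖ := norm_fst_le v
  have h2 : ‖v.2.1‖ ≤ ‖v‖ := (norm_fst_le v.2).trans (norm_snd_le v)
  have h3 : ‖v.2.2‖ ≤ ‖v‖ := (norm_snd_le v.2).trans (norm_snd_le v)
  rw [coordForm_apply, add_mul, add_mul]
  refine (norm_add₃_le).trans ?_
  simp only [norm_mul, Real.norm_eq_abs] at *
  gcongr

theorem measurable_gaussKernel (a b c : ℝ) (p : ℝ × ℝ × ℝ) :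
    Measurable (gaussKernel a b c p) := by
  unfold gaussKernel
  fun_prop

theorem norm_gaussKernel_le_one {a b c : ℝ} (ha : 0 < a) (hb : 0 < b) (hc : 0 < c)
    (p : ℝ × ℝ × ℝ) {q : ℝ} (hq : 0 < q) : ‖gaussKernel a b c p q‖ ≤ 1 := by
  rw [gaussKernel, Real.norm_eq_abs, Real.abs_exp, Real.exp_le_one_iff]
  have h1 : 0 ≤ p.1 ^ 2 / (2 * (a + q)) := by positivity
  have h2 : 0 ≤ p.2.1 ^ 2 / (2 * (b + q)) := by positivity
  have h3 : 0 ≤ p.2.2 ^ 2 / (2 * (c + q)) := by positivity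
  linarith

theorem hasFDerivAt_gaussKernel (a b c : ℝ) (p : ℝ × ℝ × ℝ) (q : ℝ) :
    HasFDerivAt (fun p => gaussKernel a b c p q)
      (gaussKernel a b c p q •
        coordForm (-(p.1 / (a + q))) (-(p.2.1 / (b + q))) (-(p.2.2 / (c + q)))) p := by
  have hx : HasFDerivAt (fun p : ℝ × ℝ × ℝ => p.1) (ContinuousLinearMap.fst ℝ ℝ (ℝ × ℝ)) p :=
    hasFDerivAt_fst
  have hs : HasFDerivAt (fun p : ℝ × ℝ × ℝ => p.2) (ContinuousLinearMap.snd ℝ ℝ (ℝ × ℝ)) p :=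
    hasFDerivAt_snd
  have hy := hs.fst
  have hz := hs.snd
  have h := ((((hx.pow 2).mul_const (2 * (a + q))⁻¹).neg.sub
    ((hy.pow 2).mul_const (2 * (b + q))⁻¹)).sub ((hz.pow 2).mul_const (2 * (c + q))⁻¹)).exp
  simp only [← div_eq_mul_inv] at h
  refine h.congr_fderiv ?_
  ext
  all_goals simp [gaussKernel, coordForm]
  all_goals field_simp

theorem integrableOn_mul_gaussKernel {a b c : ℝ} (ha : 0 < a) (hb : 0 < b) (hc : 0 < c)
    {g : ℝ → ℝ} (hg : IntegrableOn g (Set.Ioi 0)) (p : ℝ × ℝ × ℝ) :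
    IntegrableOn (fun q => g q * gaussKernel a b c p q) (Set.Ioi 0) := by
  refine Integrable.mul_bdd (c := 1) hg (measurable_gaussKernel a b c p).aestronglyMeasurable ?_
  filter_upwards [ae_restrict_mem measurableSet_Ioi] with q hq
  exact norm_gaussKernel_le_one ha hb hc p hq

theorem integrableOn_div_add {a : ℝ} (ha : 0 < a) {g : ℝ → ℝ}
    (hg : IntegrableOn g (Set.Ioi 0)) : IntegrableOn (fun q => g q / (a + q)) (Set.Ioi 0) := by
  simp only [div_eq_mul_inv]
  refine Integrable.mul_bdd (c := a⁻¹) hg (by fun_prop) ?_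
  filter_upwards [ae_restrict_mem measurableSet_Ioi] with q hq
  have hq : 0 < q := hq
  rw [norm_inv, Real.norm_eq_abs, abs_of_pos (by positivity)]
  gcongr
  linarith

theorem integral_add_three {α E : Type*} [MeasurableSpace α] {μ : Measure α}
    [NormedAddCommGroup E] [NormedSpace ℝ E] {f g h : α → E}
    (hf : Integrable f μ) (hg : Integrable g μ) (hh : Integrable h μ) :
    ∫ t, f t + g t + h t ∂μ = ∫ t, f t ∂μ + ∫ t, g t ∂μ + ∫ t, h t ∂μ := by
  rw [← integral_add hf hg]
  exact integral_add (hf.add hg) hh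

theorem hasFDerivAt_gaussMix {a b c : ℝ} (ha : 0 < a) (hb : 0 < b) (hc : 0 < c)
    {g : ℝ → ℝ} (hg : IntegrableOn g (Set.Ioi 0)) (p : ℝ × ℝ × ℝ) :
    HasFDerivAt (gaussMix a b c g)
      (coordForm (-(p.1 * gaussMix a b c (fun q => g q / (a + q)) p))
        (-(p.2.1 * gaussMix a b c (fun q => g q / (b + q)) p))
        (-(p.2.2 * gaussMix a b c (fun q => g q / (c + q)) p))) p := by
  have iA := integrableOn_mul_gaussKernel ha hb hc (integrableOn_div_add ha hg) p
  have iB := integrableOn_mul_gaussKernel ha hb hc (integrableOn_div_add hb hg) p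
  have iC := integrableOn_mul_gaussKernel ha hb hc (integrableOn_div_add hc hg) p
  have jA := iA.smul_const (coordForm (-p.1) 0 0)
  have jB := iB.smul_const (coordForm 0 (-p.2.1) 0)
  have jC := iC.smul_const (coordForm 0 0 (-p.2.2))
  have expand : ∀ q, g q • gaussKernel a b c p q •
      coordForm (-(p.1 / (a + q))) (-(p.2.1 / (b + q))) (-(p.2.2 / (c + q))) =
      (g q / (a + q) * gaussKernel a b c p q) • coordForm (-p.1) 0 0 +
      (g q / (b + q) * gaussKernel a b c p q) • coordForm 0 (-p.2.1) 0 +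
      (g q / (c + q) * gaussKernel a b c p q) • coordForm 0 0 (-p.2.2) := by
    intro q
    ext
    all_goals simp [coordForm]
    all_goals ring
  have key := hasFDerivAt_integral_of_dominated_of_fderiv_le
    (μ := volume.restrict (Set.Ioi (0 : ℝ))) (𝕜 := ℝ) (s := Metric.ball p 1)
    (F := fun p q => g q * gaussKernel a b c p q)
    (F' := fun p q => g q • gaussKernel a b c p q •
      coordForm (-(p.1 / (a + q))) (-(p.2.1 / (b + q))) (-(p.2.2 / (c + q))))
    (x₀ := p) (bound := fun q => ‖g q‖ * ((‖p‖ + 1) / a + (‖p‖ + 1) / b + (‖p‖ + 1) / c))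
    (Metric.ball_mem_nhds p one_pos)
    (.of_forall fun p' => (integrableOn_mul_gaussKernel ha hb hc hg p').aestronglyMeasurable)
    (integrableOn_mul_gaussKernel ha hb hc hg p) ?_ ?_ (hg.norm.mul_const _)
    (.of_forall fun q p' _ => (hasFDerivAt_gaussKernel a b c p' q).const_mul (g q))
  · refine key.congr_fderiv ?_
    simp only [expand]
    rw [integral_add_three jA jB jC,
      integral_smul_const, integral_smul_const, integral_smul_const]
    ext
    all_goals simp [coordForm, gaussMix]
    all_goals ring
  · simp only [expand]
    exact ((jA.add jB).add jC).aestronglyMeasurable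
  · filter_upwards [ae_restrict_mem measurableSet_Ioi] with q hq p' hp'
    have hq : 0 < q := hq
    have hp : ‖p'‖ ≤ ‖p‖ + 1 := by
      have := norm_le_norm_add_norm_sub p p'
      rw [mem_ball_iff_norm'] at hp'
      linarith
    have h1 : |p'.1| ≤ ‖p‖ + 1 := (norm_fst_le p').trans hp
    have h2 : |p'.2.1| ≤ ‖p‖ + 1 := ((norm_fst_le p'.2).trans (norm_snd_le p')).trans hp
    have h3 : |p'.2.2| ≤ ‖p‖ + 1 := ((norm_snd_le p'.2).trans (norm_snd_le p')).trans hp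
    have bd : ∀ {d r : ℝ}, 0 < d → |r| ≤ ‖p‖ + 1 → |-(r / (d + q))| ≤ (‖p‖ + 1) / d := by
      intro d r hd hr
      rw [abs_neg, abs_div, abs_of_pos (by positivity : 0 < d + q)]
      gcongr
      linarith
    rw [norm_smul, norm_smul]
    refine mul_le_mul_of_nonneg_left ?_ (norm_nonneg _)
    refine (mul_le_of_le_one_left (norm_nonneg _)
      (norm_gaussKernel_le_one ha hb hc p' hq)).trans ?_
    refine (norm_coordForm_le _ _ _).trans ?_
    gcongr
    exacts [bd ha h1, bd hb h2, bd hc h3]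

theorem differentiable_gaussMix {a b c : ℝ} (ha : 0 < a) (hb : 0 < b) (hc : 0 < c)
    {g : ℝ → ℝ} (hg : IntegrableOn g (Set.Ioi 0)) : Differentiable ℝ (gaussMix a b c g) :=
  fun p => (hasFDerivAt_gaussMix ha hb hc hg p).differentiableAt

theorem differentiable_fderiv_gaussMix {a b c : ℝ} (ha : 0 < a) (hb : 0 < b) (hc : 0 < c)
    {g : ℝ → ℝ} (hg : IntegrableOn g (Set.Ioi 0)) :
    Differentiable ℝ (fderiv ℝ (gaussMix a b c g)) := by
  rw [funext fun p => (hasFDerivAt_gaussMix ha hb hc hg p).fderiv]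
  have hA := differentiable_gaussMix ha hb hc (integrableOn_div_add ha hg)
  have hB := differentiable_gaussMix ha hb hc (integrableOn_div_add hb hg)
  have hC := differentiable_gaussMix ha hb hc (integrableOn_div_add hc hg)
  unfold coordForm
  fun_prop

theorem iteratedDeriv_two_of_hasDerivAt {f h : ℝ → ℝ} {x k : ℝ}
    (hf : ∀ t, HasDerivAt f (-(t * h t)) t) (hh : HasDerivAt h (-(x * k)) x) :
    iteratedDeriv 2 f x = -h x + x ^ 2 * k := by
  have h2 : HasDerivAt (fun t => -(t * h t)) (-(1 * h x + x * -(x * k))) x :=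
    ((hasDerivAt_id x).mul hh).neg
  rw [iteratedDeriv_succ, iteratedDeriv_one, funext fun t => (hf t).deriv, h2.deriv]
  ring

theorem hasDerivAt_gaussMix_fst {a b c : ℝ} (ha : 0 < a) (hb : 0 < b) (hc : 0 < c)
    {g : ℝ → ℝ} (hg : IntegrableOn g (Set.Ioi 0)) (x y z : ℝ) :
    HasDerivAt (fun t => gaussMix a b c g (t, y, z))
      (-(x * gaussMix a b c (fun q => g q / (a + q)) (x, y, z))) x := by
  have h := (hasFDerivAt_gaussMix ha hb hc hg (x, y, z)).comp_hasDerivAt x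
    ((hasDerivAt_id x).prodMk ((hasDerivAt_const x y).prodMk (hasDerivAt_const x z)))
  simpa [coordForm_apply, Function.comp_def] using h

theorem hasDerivAt_gaussMix_snd {a b c : ℝ} (ha : 0 < a) (hb : 0 < b) (hc : 0 < c)
    {g : ℝ → ℝ} (hg : IntegrableOn g (Set.Ioi 0)) (x y z : ℝ) :
    HasDerivAt (fun t => gaussMix a b c g (x, t, z))
      (-(y * gaussMix a b c (fun q => g q / (b + q)) (x, y, z))) y := by
  have h := (hasFDerivAt_gaussMix ha hb hc hg (x, y, z)).comp_hasDerivAt y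
    ((hasDerivAt_const y x).prodMk ((hasDerivAt_id y).prodMk (hasDerivAt_const y z)))
  simpa [coordForm_apply, Function.comp_def] using h

theorem hasDerivAt_gaussMix_trd {a b c : ℝ} (ha : 0 < a) (hb : 0 < b) (hc : 0 < c)
    {g : ℝ → ℝ} (hg : IntegrableOn g (Set.Ioi 0)) (x y z : ℝ) :
    HasDerivAt (fun t => gaussMix a b c g (x, y, t))
      (-(z * gaussMix a b c (fun q => g q / (c + q)) (x, y, z))) z := by
  have h := (hasFDerivAt_gaussMix ha hb hc hg (x, y, z)).comp_hasDerivAt z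
    ((hasDerivAt_const z x).prodMk ((hasDerivAt_const z y).prodMk (hasDerivAt_id z)))
  simpa [coordForm_apply, Function.comp_def] using h

/-- The normalising factor of `gaussKernel a b c · q`, up to a power of `2π`. -/
noncomputable def gaussWeight (a b c q : ℝ) : ℝ :=
  ((a + q) ^ ((1 : ℝ) / 2) * (b + q) ^ ((1 : ℝ) / 2) * (c + q) ^ ((1 : ℝ) / 2))⁻¹

theorem gaussWeight_nonneg {a b c : ℝ} (ha : 0 < a) (hb : 0 < b) (hc : 0 < c)
    {q : ℝ} (hq : 0 < q) : 0 ≤ gaussWeight a b c q := by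
  unfold gaussWeight
  positivity

theorem gaussWeight_le {a b c : ℝ} (ha : 0 < a) (hb : 0 < b) (hc : 0 < c)
    {q : ℝ} (hq : 0 < q) :
    gaussWeight a b c q ≤ (q + min a (min b c)) ^ (-(3 / 2) : ℝ) := by
  set m := min a (min b c) with hm
  have hm0 : 0 < m := by positivity
  have h1 : m ≤ a := min_le_left _ _
  have h2 : m ≤ b := (min_le_right _ _).trans (min_le_left _ _)
  have h3 : m ≤ c := (min_le_right _ _).trans (min_le_right _ _)
  have e : (q + m) ^ (-(3 / 2) : ℝ) =
      ((q + m) ^ ((1 : ℝ) / 2) * (q + m) ^ ((1 : ℝ) / 2) * (q + m) ^ ((1 : ℝ) / 2))⁻¹ := by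
    rw [← Real.rpow_add (by positivity), ← Real.rpow_add (by positivity),
      ← Real.rpow_neg (by positivity)]
    norm_num
  rw [e, gaussWeight, add_comm a, add_comm b, add_comm c]
  gcongr

theorem integrableOn_gaussWeight {a b c : ℝ} (ha : 0 < a) (hb : 0 < b) (hc : 0 < c) :
    IntegrableOn (gaussWeight a b c) (Set.Ioi 0) := by
  have hm : 0 < min a (min b c) := by positivity
  have h : IntegrableOn (fun q => (q + min a (min b c)) ^ (-(3 / 2) : ℝ)) (Set.Ioi 0) :=
    integrableOn_add_rpow_Ioi_of_lt (by norm_num) (by linarith)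
  refine Integrable.mono' h ?_ ?_
  · have : Measurable (gaussWeight a b c) := by unfold gaussWeight; fun_prop
    exact this.aestronglyMeasurable
  · filter_upwards [ae_restrict_mem measurableSet_Ioi] with q hq
    rw [Real.norm_eq_abs, abs_of_nonneg (gaussWeight_nonneg ha hb hc hq)]
    exact gaussWeight_le ha hb hc hq

theorem tendsto_gaussWeight_mul_gaussKernel {a b c : ℝ} (ha : 0 < a) (hb : 0 < b) (hc : 0 < c)
    (p : ℝ × ℝ × ℝ) :
    Filter.Tendsto (fun q => gaussWeight a b c q * gaussKernel a b c p q)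
      Filter.atTop (nhds 0) := by
  have h : Filter.Tendsto (fun q => (q + min a (min b c)) ^ (-(3 / 2) : ℝ))
      Filter.atTop (nhds 0) :=
    (tendsto_rpow_neg_atTop (by norm_num)).comp
      (Filter.tendsto_atTop_add_const_right _ _ Filter.tendsto_id)
  refine squeeze_zero_norm' ?_ h
  filter_upwards [Filter.eventually_gt_atTop 0] with q hq
  rw [norm_mul, Real.norm_eq_abs, abs_of_nonneg (gaussWeight_nonneg ha hb hc hq)]
  exact (mul_le_of_le_one_right (gaussWeight_nonneg ha hb hc hq)
    (norm_gaussKernel_le_one ha hb hc p hq)).trans (gaussWeight_le ha hb hc hq)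

theorem hasDerivAt_rpow_half {d q : ℝ} (h : 0 < d + q) :
    HasDerivAt (fun q => (d + q) ^ ((1 : ℝ) / 2)) ((d + q) ^ ((1 : ℝ) / 2) / (2 * (d + q))) q := by
  have := ((hasDerivAt_id q).const_add d).rpow_const (p := (1 : ℝ) / 2) (Or.inl h.ne')
  refine this.congr_deriv ?_
  simp only [id]
  rw [Real.rpow_sub_one h.ne']
  field_simp

theorem hasDerivAt_gaussWeight {a b c q : ℝ} (ha : 0 < a + q) (hb : 0 < b + q)
    (hc : 0 < c + q) :
    HasDerivAt (gaussWeight a b c)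
      (-(gaussWeight a b c q * (1 / (a + q) + 1 / (b + q) + 1 / (c + q)) / 2)) q := by
  have h := (((hasDerivAt_rpow_half ha).mul (hasDerivAt_rpow_half hb)).mul
    (hasDerivAt_rpow_half hc)).inv (by simp only [Pi.mul_apply]; positivity)
  refine h.congr_deriv ?_
  have h1 := Real.rpow_pos_of_pos ha (1 / 2)
  have h2 := Real.rpow_pos_of_pos hb (1 / 2)
  have h3 := Real.rpow_pos_of_pos hc (1 / 2)
  simp only [gaussWeight, Pi.mul_apply]
  generalize (a + q) ^ ((1 : ℝ) / 2) = r at *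
  generalize (b + q) ^ ((1 : ℝ) / 2) = s at *
  generalize (c + q) ^ ((1 : ℝ) / 2) = t at *
  field_simp

theorem hasDerivAt_gaussKernel {a b c q : ℝ} (ha : 0 < a + q) (hb : 0 < b + q)
    (hc : 0 < c + q) (p : ℝ × ℝ × ℝ) :
    HasDerivAt (gaussKernel a b c p)
      (gaussKernel a b c p q * ((p.1 ^ 2 / (a + q) ^ 2 + p.2.1 ^ 2 / (b + q) ^ 2 +
        p.2.2 ^ 2 / (c + q) ^ 2) / 2)) q := by
  have hd : ∀ d r : ℝ, 0 < d + q →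
      HasDerivAt (fun q => r / (2 * (d + q))) (-(r / (d + q) ^ 2 / 2)) q := by
    intro d r h
    refine ((hasDerivAt_const q r).div (((hasDerivAt_id q).const_add d).const_mul 2)
      (by simp only [id]; positivity)).congr_deriv ?_
    simp only [id]
    field_simp
    ring
  refine (((hd a (p.1 ^ 2) ha).neg.sub (hd b (p.2.1 ^ 2) hb)).sub
    (hd c (p.2.2 ^ 2) hc)).exp.congr_deriv ?_
  simp only [gaussKernel, Pi.sub_apply, Pi.neg_apply]
  ring

theorem integral_gaussMix_second_deriv {a b c d : ℝ} (ha : 0 < a) (hb : 0 < b) (hc : 0 < c)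
    (hd : 0 < d) {g : ℝ → ℝ} (hg : IntegrableOn g (Set.Ioi 0)) (p : ℝ × ℝ × ℝ) (r : ℝ) :
    IntegrableOn (fun q => (-1 / (d + q) + r / (d + q) ^ 2) * (g q * gaussKernel a b c p q))
      (Set.Ioi 0) ∧
    ∫ q in Set.Ioi 0, (-1 / (d + q) + r / (d + q) ^ 2) * (g q * gaussKernel a b c p q) =
      -gaussMix a b c (fun q => g q / (d + q)) p +
        r * gaussMix a b c (fun q => g q / (d + q) / (d + q)) p := by
  have i1 := (integrableOn_mul_gaussKernel ha hb hc (integrableOn_div_add hd hg) p).const_mul (-1)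
  have i2 := (integrableOn_mul_gaussKernel ha hb hc
    (integrableOn_div_add hd (integrableOn_div_add hd hg)) p).const_mul r
  have e : ∀ q, (-1 / (d + q) + r / (d + q) ^ 2) * (g q * gaussKernel a b c p q) =
      -1 * (g q / (d + q) * gaussKernel a b c p q) +
        r * (g q / (d + q) / (d + q) * gaussKernel a b c p q) := by
    intro q
    generalize d + q = D
    ring
  simp only [e]
  refine ⟨i1.add i2, ?_⟩
  rw [integral_add i1 i2, integral_const_mul, integral_const_mul, neg_one_mul]
  rfl

/-- The Laplacian of the mixture collapses to the boundary term at `q = 0`. -/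
theorem gaussMix_gaussWeight_laplacian {a b c : ℝ} (ha : 0 < a) (hb : 0 < b) (hc : 0 < c)
    (p : ℝ × ℝ × ℝ) :
    (-gaussMix a b c (fun q => gaussWeight a b c q / (a + q)) p + p.1 ^ 2 *
        gaussMix a b c (fun q => gaussWeight a b c q / (a + q) / (a + q)) p) +
      (-gaussMix a b c (fun q => gaussWeight a b c q / (b + q)) p + p.2.1 ^ 2 *
        gaussMix a b c (fun q => gaussWeight a b c q / (b + q) / (b + q)) p) +
      (-gaussMix a b c (fun q => gaussWeight a b c q / (c + q)) p + p.2.2 ^ 2 *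
        gaussMix a b c (fun q => gaussWeight a b c q / (c + q) / (c + q)) p) =
    -(2 * (gaussWeight a b c 0 * gaussKernel a b c p 0)) := by
  have hw := integrableOn_gaussWeight ha hb hc
  obtain ⟨i₁, h₁⟩ := integral_gaussMix_second_deriv ha hb hc ha hw p (p.1 ^ 2)
  obtain ⟨i₂, h₂⟩ := integral_gaussMix_second_deriv ha hb hc hb hw p (p.2.1 ^ 2)
  obtain ⟨i₃, h₃⟩ := integral_gaussMix_second_deriv ha hb hc hc hw p (p.2.2 ^ 2)
  have hderiv : ∀ q ∈ Set.Ici (0 : ℝ),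
      HasDerivAt (fun q => 2 * (gaussWeight a b c q * gaussKernel a b c p q))
        ((-1 / (a + q) + p.1 ^ 2 / (a + q) ^ 2) * (gaussWeight a b c q * gaussKernel a b c p q) +
        (-1 / (b + q) + p.2.1 ^ 2 / (b + q) ^ 2) * (gaussWeight a b c q * gaussKernel a b c p q) +
        (-1 / (c + q) + p.2.2 ^ 2 / (c + q) ^ 2) *
          (gaussWeight a b c q * gaussKernel a b c p q)) q := by
    intro q hq
    have hq : 0 ≤ q := hq
    have hA : 0 < a + q := by linarith
    have hB : 0 < b + q := by linarith
    have hC : 0 < c + q := by linarith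
    refine (((hasDerivAt_gaussWeight hA hB hC).mul
      (hasDerivAt_gaussKernel hA hB hC p)).const_mul 2).congr_deriv ?_
    generalize gaussWeight a b c q = w
    generalize gaussKernel a b c p q = k
    generalize a + q = A
    generalize b + q = B
    generalize c + q = C
    ring
  have key := integral_Ioi_of_hasDerivAt_of_tendsto' hderiv ((i₁.add i₂).add i₃)
    ((tendsto_gaussWeight_mul_gaussKernel ha hb hc p).const_mul 2)
  rw [integral_add_three i₁ i₂ i₃, h₁, h₂, h₃] at key
  rw [key, mul_zero, zero_sub]

/-- The integral representation of the 3D potential of a Gaussian bunch is twice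
differentiable and solves the Poisson equation with a 3D Gaussian source. -/
theorem poisson_3d_integral_representation (a b c : ℝ)
    (ha : 0 < a) (hb : 0 < b) (hc : 0 < c)
    (u : ℝ → ℝ → ℝ → ℝ)
    (hu : ∀ x y z, u x y z = ∫ q in Set.Ioi (0 : ℝ),
      Real.exp (-(x ^ 2 / (2 * (a + q))) - y ^ 2 / (2 * (b + q))
          - z ^ 2 / (2 * (c + q))) /
        ((a + q) ^ ((1 : ℝ) / 2) * (b + q) ^ ((1 : ℝ) / 2) * (c + q) ^ ((1 : ℝ) / 2))) :
    (Differentiable ℝ (fun p : ℝ × ℝ × ℝ => u p.1 p.2.1 p.2.2) ∧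
      Differentiable ℝ (fderiv ℝ (fun p : ℝ × ℝ × ℝ => u p.1 p.2.1 p.2.2))) ∧
    ∀ x y z,
      iteratedDeriv 2 (fun x' => u x' y z) x
        + iteratedDeriv 2 (fun y' => u x y' z) y
        + iteratedDeriv 2 (fun z' => u x y z') z
        = -(2 / (a * b * c) ^ ((1 : ℝ) / 2)) *
            Real.exp (-(x ^ 2 / (2 * a)) - y ^ 2 / (2 * b) - z ^ 2 / (2 * c)) := by
  have hw := integrableOn_gaussWeight ha hb hc
  have hu' : ∀ x y z, u x y z = gaussMix a b c (gaussWeight a b c) (x, y, z) := by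
    intro x y z
    rw [hu, gaussMix]
    simp only [gaussWeight, gaussKernel, div_eq_inv_mul]
  simp only [hu']
  refine ⟨⟨differentiable_gaussMix ha hb hc hw, differentiable_fderiv_gaussMix ha hb hc hw⟩,
    fun x y z => ?_⟩
  have hA := integrableOn_div_add ha hw
  have hB := integrableOn_div_add hb hw
  have hC := integrableOn_div_add hc hw
  rw [iteratedDeriv_two_of_hasDerivAt
      (fun t => hasDerivAt_gaussMix_fst ha hb hc hw t y z)
      (hasDerivAt_gaussMix_fst ha hb hc hA x y z),
    iteratedDeriv_two_of_hasDerivAt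
      (fun t => hasDerivAt_gaussMix_snd ha hb hc hw x t z)
      (hasDerivAt_gaussMix_snd ha hb hc hB x y z),
    iteratedDeriv_two_of_hasDerivAt
      (fun t => hasDerivAt_gaussMix_trd ha hb hc hw x y t)
      (hasDerivAt_gaussMix_trd ha hb hc hC x y z)]
  refine (gaussMix_gaussWeight_laplacian ha hb hc (x, y, z)).trans ?_
  rw [Real.mul_rpow (by positivity) hc.le, Real.mul_rpow ha.le hb.le]
  simp only [gaussWeight, gaussKernel, add_zero]
  ring
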